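/- Define Φ from the m-fold product of copies of the zigzag-or-edge paths to the zigzag as follows: given oriented paths P_1,…,P_m each equal to either a single edge E (vertices {s,t} with edge s→t) or the zigzag Z, with at least one P_i equal to Z, and the unique isomorphisms φ_i: P_i → Z for those i with P_i = Z, define Φ(u_1,…,u_m) to be the vertex among {φ_i(u_i) : P_i = Z} of minimal distance from the initial vertex of Z, where tuples (u_1,…,u_m) range over ∏P_i restricted to tuples of constant level. Then Φ is a digraph homomorphism from (the constant-level part of) ∏P_i to Z, and Φ maps the tuple of initial vertices to ιZ and the tuple of terminal vertices to τZ. -/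

import Mathlib

/-- Vertices of the two possible connecting-path segments: a zigzag (true) on
    four vertices or a single edge (false) on two vertices. -/
abbrev PV18 : Bool → Type
  | true => Fin 4
  | false => Fin 2

/-- The zigzag Z = 00→01←10→11, with vertices indexed by distance from the
    initial vertex 00:  0 = 00, 1 = 01, 2 = 10, 3 = 11.
    Edges: 00→01, 10→01, 10→11. -/
def zedge18 : Fin 4 → Fin 4 → Prop := fun x y =>
  (x = 0 ∧ y = 1) ∨ (x = 2 ∧ y = 1) ∨ (x = 2 ∧ y = 3)

/-- Edges of each segment: the zigzag edges, or the single edge 0→1. -/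
def PEdge18 : (b : Bool) → PV18 b → PV18 b → Prop
  | true => zedge18
  | false => fun x y => x = 0 ∧ y = 1

/-- Levels: lvl(00)=lvl(10)=0, lvl(01)=lvl(11)=1 on the zigzag; 0,1 on an edge. -/
def Plvl18 : (b : Bool) → PV18 b → ℕ
  | true => fun x => if x = 0 ∨ x = 2 then 0 else 1
  | false => fun x => x.1

/-- The unique isomorphism onto the zigzag for zigzag segments (identity);
    junk value on edge segments. -/
def toZ18 : (b : Bool) → PV18 b → Fin 4
  | true => id
  | false => fun _ => 0

/-- Initial vertex of a segment. -/
def iota18 : (b : Bool) → PV18 b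
  | true => 0
  | false => 0

/-- Terminal vertex of a segment. -/
def tau18 : (b : Bool) → PV18 b
  | true => 3
  | false => 1

/-- Φ(u₁,…,u_m): the vertex among {φ_i(u_i) : P_i a zigzag} of minimal
    distance from the initial vertex of Z. -/
def Phi18 {m : ℕ} (c : Fin m → Bool)
    (h : (Finset.univ.filter fun i => c i = true).Nonempty)
    (u : ∀ i, PV18 (c i)) : Fin 4 :=
  (Finset.univ.filter fun i => c i = true).inf' h (fun i => toZ18 (c i) (u i))

/-- The edge relation of the zigzag is preserved by the binary minimum. -/
theorem zedge18_inf {a b x y : Fin 4} (hab : zedge18 a b) (hxy : zedge18 x y) :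
    zedge18 (a ⊓ x) (b ⊓ y) := by
  unfold zedge18 at *
  revert a b x y
  decide

/-- The edge relation of the zigzag is preserved by nonempty finite minima. -/
theorem zedge18_inf' {ι : Type*} {s : Finset ι} (hs : s.Nonempty) {f g : ι → Fin 4}
    (hfg : ∀ i ∈ s, zedge18 (f i) (g i)) : zedge18 (s.inf' hs f) (s.inf' hs g) := by
  induction hs using Finset.Nonempty.cons_induction with
  | singleton a => simpa using hfg
  | cons a s ha hs ih =>
    rw [Finset.inf'_cons hs, Finset.inf'_cons hs]
    exact zedge18_inf (hfg a (Finset.mem_cons_self a s))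
      (ih fun i hi => hfg i (Finset.mem_cons_of_mem hi))

theorem zedge18_toZ18 {b : Bool} (hb : b = true) {x y : PV18 b} (hxy : PEdge18 b x y) :
    zedge18 (toZ18 b x) (toZ18 b y) := by
  subst hb
  exact hxy

theorem toZ18_iota18 {b : Bool} (hb : b = true) : toZ18 b (iota18 b) = 0 := by
  subst hb
  rfl

theorem toZ18_tau18 {b : Bool} (hb : b = true) : toZ18 b (tau18 b) = 3 := by
  subst hb
  rfl

/-- Φ is a homomorphism from the constant-level part of ∏ P_i to Z, mapping
    the tuple of initial vertices to ιZ and the tuple of terminal vertices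
    to τZ. -/
theorem stmt18 {m : ℕ} (c : Fin m → Bool)
    (h : (Finset.univ.filter fun i => c i = true).Nonempty) :
    (∀ u v : (∀ i, PV18 (c i)),
      (∃ L, ∀ i, Plvl18 (c i) (u i) = L) →
      (∃ L, ∀ i, Plvl18 (c i) (v i) = L) →
      (∀ i, PEdge18 (c i) (u i) (v i)) →
      zedge18 (Phi18 c h u) (Phi18 c h v)) ∧
    Phi18 c h (fun i => iota18 (c i)) = 0 ∧
    Phi18 c h (fun i => tau18 (c i)) = 3 := by
  refine ⟨fun u v _ _ huv => ?_, ?_, ?_⟩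
  · exact zedge18_inf' h fun i hi => zedge18_toZ18 (Finset.mem_filter.1 hi).2 (huv i)
  · exact (Finset.inf'_congr h rfl fun i hi => toZ18_iota18 (Finset.mem_filter.1 hi).2).trans
      (Finset.inf'_const h 0)
  · exact (Finset.inf'_congr h rfl fun i hi => toZ18_tau18 (Finset.mem_filter.1 hi).2).trans
      (Finset.inf'_const h 3)
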